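/- arXiv:1608.01641 — 3 statements merged into one kernel-verified Lean document; each statement's English description precedes it below -/
import Mathlib

section
/- W acts on h* by the contragredient action, and s ∈ W is a reflection for the action on h* if and only if it is a reflection for the action on h; for the Cherednik algebra H_c(W,h*) one may take as eigenvector data α′_s := α_s^∨ ∈ (h*)* = h and (α′_s)^∨ := α_s ∈ h*. Then the assignment x ↦ x for x ∈ h*, y ↦ −y for y ∈ h, and g ↦ g for g ∈ W extends to a ℂ-algebra isomorphism (the Fourier transform) H_c(W,h) → H_c(W,h*). -/
noncomputable section

open FreeAlgebra

/-- Relations presenting a rational Cherednik algebra.  Here `A` is the space of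
`y`-generators (playing the role of `𝔥`), `B` the space of `x`-generators (playing the role
of `𝔥*`), `P` the natural pairing `⟨x,y⟩`, `ρA g`, `ρB g` the actions of `g ∈ W` on `A` and
`B`, `c : W → ℂ` the parameter (extended by zero off the set of reflections), and `α s ∈ B`,
`αv s ∈ A` the chosen eigenvector data.  The relations are: `ℂ`-linearity of the generators
from `A` and `B`, the group relations of `W`, `[x,x′] = 0`, `[y,y′] = 0`, the equivariance
relations `g·x = g(x)·g`, `g·y = g(y)·g`, and the main commutation relation
`[y,x] = ⟨x,y⟩ − Σ_s c(s) ⟨α_s,y⟩ ⟨x,α_s^∨⟩ s`. -/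
inductive CherednikRel {W : Type} [Group W] [Fintype W]
    {A : Type} [AddCommGroup A] [Module ℂ A] {B : Type} [AddCommGroup B] [Module ℂ B]
    (P : B →ₗ[ℂ] A →ₗ[ℂ] ℂ) (ρA : W → A →ₗ[ℂ] A) (ρB : W → B →ₗ[ℂ] B)
    (c : W → ℂ) (α : W → B) (αv : W → A) :
    FreeAlgebra ℂ (A ⊕ B ⊕ W) → FreeAlgebra ℂ (A ⊕ B ⊕ W) → Prop
  | y_add (y y' : A) : CherednikRel P ρA ρB c α αv
      (ι ℂ (Sum.inl (y + y'))) (ι ℂ (Sum.inl y) + ι ℂ (Sum.inl y'))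
  | y_smul (a : ℂ) (y : A) : CherednikRel P ρA ρB c α αv
      (ι ℂ (Sum.inl (a • y))) (a • ι ℂ (Sum.inl y))
  | x_add (x x' : B) : CherednikRel P ρA ρB c α αv
      (ι ℂ (Sum.inr (Sum.inl (x + x')))) (ι ℂ (Sum.inr (Sum.inl x)) + ι ℂ (Sum.inr (Sum.inl x')))
  | x_smul (a : ℂ) (x : B) : CherednikRel P ρA ρB c α αv
      (ι ℂ (Sum.inr (Sum.inl (a • x)))) (a • ι ℂ (Sum.inr (Sum.inl x)))
  | w_mul (g g' : W) : CherednikRel P ρA ρB c α αv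
      (ι ℂ (Sum.inr (Sum.inr (g * g')))) (ι ℂ (Sum.inr (Sum.inr g)) * ι ℂ (Sum.inr (Sum.inr g')))
  | w_one : CherednikRel P ρA ρB c α αv (ι ℂ (Sum.inr (Sum.inr (1 : W)))) 1
  | x_comm (x x' : B) : CherednikRel P ρA ρB c α αv
      (ι ℂ (Sum.inr (Sum.inl x)) * ι ℂ (Sum.inr (Sum.inl x')))
      (ι ℂ (Sum.inr (Sum.inl x')) * ι ℂ (Sum.inr (Sum.inl x)))
  | y_comm (y y' : A) : CherednikRel P ρA ρB c α αv
      (ι ℂ (Sum.inl y) * ι ℂ (Sum.inl y')) (ι ℂ (Sum.inl y') * ι ℂ (Sum.inl y))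
  | conj_x (g : W) (x : B) : CherednikRel P ρA ρB c α αv
      (ι ℂ (Sum.inr (Sum.inr g)) * ι ℂ (Sum.inr (Sum.inl x)))
      (ι ℂ (Sum.inr (Sum.inl (ρB g x))) * ι ℂ (Sum.inr (Sum.inr g)))
  | conj_y (g : W) (y : A) : CherednikRel P ρA ρB c α αv
      (ι ℂ (Sum.inr (Sum.inr g)) * ι ℂ (Sum.inl y))
      (ι ℂ (Sum.inl (ρA g y)) * ι ℂ (Sum.inr (Sum.inr g)))
  | main (y : A) (x : B) : CherednikRel P ρA ρB c α αv
      (ι ℂ (Sum.inl y) * ι ℂ (Sum.inr (Sum.inl x))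
        - ι ℂ (Sum.inr (Sum.inl x)) * ι ℂ (Sum.inl y))
      (algebraMap ℂ _ (P x y)
        - ∑ s : W, (c s * P (α s) y * P x (αv s)) • ι ℂ (Sum.inr (Sum.inr s)))

/-- The rational Cherednik algebra presented by the relations `CherednikRel`. -/
def CherednikAlgebra {W : Type} [Group W] [Fintype W]
    {A : Type} [AddCommGroup A] [Module ℂ A] {B : Type} [AddCommGroup B] [Module ℂ B]
    (P : B →ₗ[ℂ] A →ₗ[ℂ] ℂ) (ρA : W → A →ₗ[ℂ] A) (ρB : W → B →ₗ[ℂ] B)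
    (c : W → ℂ) (α : W → B) (αv : W → A) : Type :=
  RingQuot (CherednikRel P ρA ρB c α αv)

noncomputable instance {W : Type} [Group W] [Fintype W]
    {A : Type} [AddCommGroup A] [Module ℂ A] {B : Type} [AddCommGroup B] [Module ℂ B]
    (P : B →ₗ[ℂ] A →ₗ[ℂ] ℂ) (ρA : W → A →ₗ[ℂ] A) (ρB : W → B →ₗ[ℂ] B)
    (c : W → ℂ) (α : W → B) (αv : W → A) : Ring (CherednikAlgebra P ρA ρB c α αv) :=
  inferInstanceAs (Ring (RingQuot (CherednikRel P ρA ρB c α αv)))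

noncomputable instance {W : Type} [Group W] [Fintype W]
    {A : Type} [AddCommGroup A] [Module ℂ A] {B : Type} [AddCommGroup B] [Module ℂ B]
    (P : B →ₗ[ℂ] A →ₗ[ℂ] ℂ) (ρA : W → A →ₗ[ℂ] A) (ρB : W → B →ₗ[ℂ] B)
    (c : W → ℂ) (α : W → B) (αv : W → A) : Algebra ℂ (CherednikAlgebra P ρA ρB c α αv) :=
  inferInstanceAs (Algebra ℂ (RingQuot (CherednikRel P ρA ρB c α αv)))

/-- The image of `y ∈ 𝔥` in the Cherednik algebra. -/
def yGen {W : Type} [Group W] [Fintype W]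
    {A : Type} [AddCommGroup A] [Module ℂ A] {B : Type} [AddCommGroup B] [Module ℂ B]
    (P : B →ₗ[ℂ] A →ₗ[ℂ] ℂ) (ρA : W → A →ₗ[ℂ] A) (ρB : W → B →ₗ[ℂ] B)
    (c : W → ℂ) (α : W → B) (αv : W → A) (y : A) : CherednikAlgebra P ρA ρB c α αv :=
  RingQuot.mkAlgHom ℂ (CherednikRel P ρA ρB c α αv) (ι ℂ (Sum.inl y))

/-- The image of `x ∈ 𝔥*` in the Cherednik algebra. -/
def xGen {W : Type} [Group W] [Fintype W]
    {A : Type} [AddCommGroup A] [Module ℂ A] {B : Type} [AddCommGroup B] [Module ℂ B]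
    (P : B →ₗ[ℂ] A →ₗ[ℂ] ℂ) (ρA : W → A →ₗ[ℂ] A) (ρB : W → B →ₗ[ℂ] B)
    (c : W → ℂ) (α : W → B) (αv : W → A) (x : B) : CherednikAlgebra P ρA ρB c α αv :=
  RingQuot.mkAlgHom ℂ (CherednikRel P ρA ρB c α αv) (ι ℂ (Sum.inr (Sum.inl x)))

/-- The image of `g ∈ W` in the Cherednik algebra. -/
def wGen {W : Type} [Group W] [Fintype W]
    {A : Type} [AddCommGroup A] [Module ℂ A] {B : Type} [AddCommGroup B] [Module ℂ B]
    (P : B →ₗ[ℂ] A →ₗ[ℂ] ℂ) (ρA : W → A →ₗ[ℂ] A) (ρB : W → B →ₗ[ℂ] B)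
    (c : W → ℂ) (α : W → B) (αv : W → A) (g : W) : CherednikAlgebra P ρA ρB c α αv :=
  RingQuot.mkAlgHom ℂ (CherednikRel P ρA ρB c α αv) (ι ℂ (Sum.inr (Sum.inr g)))

/-- `s` is a reflection for the linear action `σ` of `W` on `V`: `s ≠ 1` and the fixed
subspace of `s` has codimension `1` in `V`. -/
def IsReflectionOn {W : Type} [Group W] (V : Type) [AddCommGroup V] [Module ℂ V]
    (σ : W → V →ₗ[ℂ] V) (s : W) : Prop :=
  s ≠ 1 ∧ Module.finrank ℂ V = Module.finrank ℂ (Module.End.eigenspace (σ s) 1) + 1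

section helpers

variable {W : Type} [Group W] [Fintype W]
    {A : Type} [AddCommGroup A] [Module ℂ A] {B : Type} [AddCommGroup B] [Module ℂ B]
    (P : B →ₗ[ℂ] A →ₗ[ℂ] ℂ) (ρA : W → A →ₗ[ℂ] A) (ρB : W → B →ₗ[ℂ] B)
    (c : W → ℂ) (α : W → B) (αv : W → A)

/-- Values of the Fourier transform on generators, with a sign. -/
def fourierGen (Q : A →ₗ[ℂ] B →ₗ[ℂ] ℂ) (ε : ℂ) :
    A ⊕ B ⊕ W → RingQuot (CherednikRel Q ρB ρA c αv α)
  | Sum.inl y => (-ε) • RingQuot.mkAlgHom ℂ (CherednikRel Q ρB ρA c αv α)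
      (ι ℂ (Sum.inr (Sum.inl y)))
  | Sum.inr (Sum.inl x) => ε • RingQuot.mkAlgHom ℂ (CherednikRel Q ρB ρA c αv α)
      (ι ℂ (Sum.inl x))
  | Sum.inr (Sum.inr g) => RingQuot.mkAlgHom ℂ (CherednikRel Q ρB ρA c αv α)
      (ι ℂ (Sum.inr (Sum.inr g)))

theorem neg_one_smul_ringAlg {R : Type*} [Ring R] [Algebra ℂ R] (u : R) :
    (-1 : ℂ) • u = - u := neg_one_smul ℂ u

theorem neg_one_smul_cherednik (u : CherednikAlgebra P ρA ρB c α αv) :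
    (-1 : ℂ) • u = - u := neg_one_smul_ringAlg u

theorem neg_one_smul_ringQuot (u : RingQuot (CherednikRel P ρA ρB c α αv)) :
    (-1 : ℂ) • u = - u := neg_one_smul_cherednik P ρA ρB c α αv u

theorem fourier_rel (Q : A →ₗ[ℂ] B →ₗ[ℂ] ℂ) (hQ : ∀ x y, Q y x = P x y) (ε : ℂ)
    (hε : ε * ε = 1) ⦃a b : FreeAlgebra ℂ (A ⊕ B ⊕ W)⦄
    (hab : CherednikRel P ρA ρB c α αv a b) :
    FreeAlgebra.lift ℂ (fourierGen ρA ρB c α αv Q ε) a =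
      FreeAlgebra.lift ℂ (fourierGen ρA ρB c α αv Q ε) b := by
  have key : ∀ {u v}, CherednikRel Q ρB ρA c αv α u v →
      RingQuot.mkAlgHom ℂ (CherednikRel Q ρB ρA c αv α) u =
      RingQuot.mkAlgHom ℂ (CherednikRel Q ρB ρA c αv α) v :=
    fun h => RingQuot.mkAlgHom_rel ℂ h
  cases hab with
  | y_add y y' =>
    simp only [map_add, FreeAlgebra.lift_ι_apply, fourierGen, key (.x_add y y'), smul_add]
  | y_smul a y =>
    simp only [map_smul, FreeAlgebra.lift_ι_apply, fourierGen, key (.x_smul a y)]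
    rw [smul_comm]
  | x_add y y' =>
    simp only [map_add, FreeAlgebra.lift_ι_apply, fourierGen, key (.y_add y y'), smul_add]
  | x_smul a y =>
    simp only [map_smul, FreeAlgebra.lift_ι_apply, fourierGen, key (.y_smul a y)]
    rw [smul_comm]
  | w_mul g g' =>
    simp only [map_mul, FreeAlgebra.lift_ι_apply, fourierGen, key (.w_mul g g')]
  | w_one =>
    simp only [map_one, FreeAlgebra.lift_ι_apply, fourierGen, key .w_one]
  | x_comm x x' =>
    have := key (.y_comm x x')
    simp only [map_mul] at this
    simp only [map_mul, FreeAlgebra.lift_ι_apply, fourierGen, smul_mul_smul_comm, this]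
  | y_comm x x' =>
    have := key (.x_comm x x')
    simp only [map_mul] at this
    simp only [map_mul, FreeAlgebra.lift_ι_apply, fourierGen, smul_mul_smul_comm, this]
  | conj_x g x =>
    have := key (.conj_y g x)
    simp only [map_mul] at this
    simp only [map_mul, FreeAlgebra.lift_ι_apply, fourierGen, smul_mul_assoc, mul_smul_comm, this]
  | conj_y g x =>
    have := key (.conj_x g x)
    simp only [map_mul] at this
    simp only [map_mul, FreeAlgebra.lift_ι_apply, fourierGen, smul_mul_assoc, mul_smul_comm, this]
  | main y x =>
    have := key (.main x y)
    simp only [map_mul, map_sub, map_sum, map_smul, AlgHom.commutes, hQ] at this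
    simp only [map_mul, map_sub, map_sum, map_smul, AlgHom.commutes,
      FreeAlgebra.lift_ι_apply, fourierGen, smul_mul_smul_comm, neg_mul, mul_neg, hε,
      neg_one_smul_ringQuot]
    rw [neg_sub_neg, this]
    congr 1
    refine Finset.sum_congr rfl fun s _ => ?_
    rw [mul_right_comm]

/-- The Fourier transform as an algebra homomorphism, with a sign. -/
def fourierHom (Q : A →ₗ[ℂ] B →ₗ[ℂ] ℂ) (hQ : ∀ x y, Q y x = P x y) (ε : ℂ)
    (hε : ε * ε = 1) :
    RingQuot (CherednikRel P ρA ρB c α αv) →ₐ[ℂ] RingQuot (CherednikRel Q ρB ρA c αv α) :=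
  RingQuot.liftAlgHom ℂ ⟨FreeAlgebra.lift ℂ (fourierGen ρA ρB c α αv Q ε),
    fourier_rel P ρA ρB c α αv Q hQ ε hε⟩

theorem fourierHom_gen (Q : A →ₗ[ℂ] B →ₗ[ℂ] ℂ) (hQ : ∀ x y, Q y x = P x y) (ε : ℂ)
    (hε : ε * ε = 1) (t : A ⊕ B ⊕ W) :
    fourierHom P ρA ρB c α αv Q hQ ε hε
      (RingQuot.mkAlgHom ℂ (CherednikRel P ρA ρB c α αv) (ι ℂ t)) =
      fourierGen ρA ρB c α αv Q ε t := by
  simp [fourierHom]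

theorem fourierHom_comp (Q : A →ₗ[ℂ] B →ₗ[ℂ] ℂ) (hQ : ∀ x y, Q y x = P x y)
    (hP : ∀ y x, P x y = Q y x) (ε δ : ℂ)
    (hε : ε * ε = 1) (hδ : δ * δ = 1) (hεδ : ε * δ = -1) :
    (fourierHom Q ρB ρA c αv α P hP δ hδ).comp (fourierHom P ρA ρB c α αv Q hQ ε hε) =
      AlgHom.id ℂ _ := by
  apply RingQuot.ringQuot_ext'
  apply FreeAlgebra.hom_ext
  funext t
  simp only [Function.comp_apply, AlgHom.comp_apply, AlgHom.id_apply, fourierHom_gen]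
  rcases t with y | x | g
  · simp only [fourierGen, map_smul, fourierHom_gen, smul_smul]
    simp [hεδ]
  · simp only [fourierGen, map_smul, fourierHom_gen, smul_smul]
    simp [hεδ]
  · simp only [fourierGen, fourierHom_gen]

theorem finrank_eigenspace_dual (h : Type) [AddCommGroup h] [Module ℂ h] [FiniteDimensional ℂ h]
    (ρ : Representation ℂ W h) (s : W) :
    Module.finrank ℂ (Module.End.eigenspace ((ρ s⁻¹).dualMap) 1) =
      Module.finrank ℂ (Module.End.eigenspace (ρ s) 1) := by
  have e1 : Module.End.eigenspace (ρ s) 1 = LinearMap.ker (ρ s⁻¹ - 1) := by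
    ext v
    simp only [Module.End.mem_eigenspace_iff, one_smul, LinearMap.mem_ker, LinearMap.sub_apply,
      Module.End.one_apply, sub_eq_zero]
    constructor
    · intro hv
      conv_lhs => rw [← hv]
      simp
    · intro hv
      conv_lhs => rw [← hv]
      simp
  have e2 : Module.End.eigenspace ((ρ s⁻¹).dualMap) 1 =
      LinearMap.ker ((ρ s⁻¹ - 1 : h →ₗ[ℂ] h).dualMap) := by
    ext f
    simp only [Module.End.mem_eigenspace_iff, one_smul, LinearMap.mem_ker, LinearMap.ext_iff,
      LinearMap.dualMap_apply, LinearMap.sub_apply, map_sub, Module.End.one_apply,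
      LinearMap.zero_apply, sub_eq_zero]
  rw [e1, e2]
  have h1 := LinearMap.finrank_range_add_finrank_ker (ρ s⁻¹ - 1 : h →ₗ[ℂ] h)
  have h2 := LinearMap.finrank_range_add_finrank_ker (ρ s⁻¹ - 1 : h →ₗ[ℂ] h).dualMap
  rw [LinearMap.finrank_range_dualMap_eq_finrank_range, Subspace.dual_finrank_eq] at h2
  omega

end helpers

/-- `W` acts on `𝔥*` by the contragredient action, and `s ∈ W` is a reflection on `𝔥*` iff it
is a reflection on `𝔥`; taking for `H_c(W,𝔥*)` the eigenvector data `α′_s := α_s^∨` and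
`(α′_s)^∨ := α_s`, the assignment `x ↦ x` (`x ∈ 𝔥*`), `y ↦ −y` (`y ∈ 𝔥`), `g ↦ g` (`g ∈ W`)
extends to a `ℂ`-algebra isomorphism (the Fourier transform) `H_c(W,𝔥) → H_c(W,𝔥*)`. -/
theorem fourier_transform_cherednik
    (h : Type) [AddCommGroup h] [Module ℂ h] [FiniteDimensional ℂ h]
    (W : Type) [Group W] [Fintype W] (ρ : Representation ℂ W h)
    (c : W → ℂ) (α : W → Module.Dual ℂ h) (αv : W → h)
    (hc : ∀ s : W, ¬ IsReflectionOn h (fun g => (ρ g : h →ₗ[ℂ] h)) s → c s = 0)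
    (hconj : ∀ g s : W, c (g * s * g⁻¹) = c s)
    (hα : ∀ s : W, IsReflectionOn h (fun g => (ρ g : h →ₗ[ℂ] h)) s →
        α s ≠ 0 ∧ ∃ μ : ℂ, μ ≠ 1 ∧ (ρ s⁻¹).dualMap (α s) = μ • α s)
    (hαv : ∀ s : W, IsReflectionOn h (fun g => (ρ g : h →ₗ[ℂ] h)) s →
        αv s ≠ 0 ∧ ∃ μ : ℂ, μ ≠ 1 ∧ ρ s (αv s) = μ • αv s)
    (hnorm : ∀ s : W, IsReflectionOn h (fun g => (ρ g : h →ₗ[ℂ] h)) s → α s (αv s) = 2) :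
    (∀ s : W, IsReflectionOn h (fun g => (ρ g : h →ₗ[ℂ] h)) s ↔
        IsReflectionOn (Module.Dual ℂ h) (fun g => (ρ g⁻¹).dualMap) s) ∧
    ∃ Φ : CherednikAlgebra ((Module.Dual.eval ℂ h).flip) (fun g => (ρ g : h →ₗ[ℂ] h))
            (fun g => (ρ g⁻¹).dualMap) c α αv ≃ₐ[ℂ]
          CherednikAlgebra (Module.Dual.eval ℂ h) (fun g => (ρ g⁻¹).dualMap)
            (fun g => (ρ g : h →ₗ[ℂ] h)) c αv α,
      (∀ x : Module.Dual ℂ h, Φ (xGen _ _ _ c α αv x) = yGen _ _ _ c αv α x) ∧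
      (∀ y : h, Φ (yGen _ _ _ c α αv y) = - xGen _ _ _ c αv α y) ∧
      (∀ g : W, Φ (wGen _ _ _ c α αv g) = wGen _ _ _ c αv α g) := by
  refine ⟨fun s => ?_, ?_⟩
  · unfold IsReflectionOn
    rw [finrank_eigenspace_dual, Subspace.dual_finrank_eq]
  · refine ⟨AlgEquiv.ofAlgHom
      (fourierHom _ _ _ c α αv (Module.Dual.eval ℂ h) (fun _ _ => rfl) 1 (by norm_num))
      (fourierHom _ _ _ c αv α _ (fun _ _ => rfl) (-1) (by norm_num))
      (fourierHom_comp _ _ _ c αv α _ _ _ _ _ _ _ (by norm_num))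
      (fourierHom_comp _ _ _ c α αv _ _ _ _ _ _ _ (by norm_num)), ?_, ?_, ?_⟩
    · intro x
      exact (fourierHom_gen _ _ _ c α αv _ _ _ _ _).trans (one_smul ℂ _)
    · intro y
      exact (fourierHom_gen _ _ _ c α αv _ _ _ _ _).trans (neg_one_smul_cherednik _ _ _ c αv α _)
    · intro g
      exact fourierHom_gen _ _ _ c α αv _ _ _ _ _
end
end

section
/- For an integer k, the subspace x^k ℂ[x] (the span of the monomials x^n with n ≥ k) is an invariant subspace of ℂ[x,x⁻¹] if and only if both of the following hold: (a) x·p has no terms of negative degree (i.e. x·p ∈ ℂ[x^m]); and (b) k + p₋₁ + Σ_{i=1}^{m−1} 2c_i(1−λ^{ik})/(1−λ^i) = 0. -/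
noncomputable section

/-- The Laurent polynomial ring `ℂ[x,x⁻¹]`, viewed as the space of finitely supported
coefficient functions `ℤ →₀ ℂ`; the monomial `x^n` is `Finsupp.single n 1`. -/
abbrev LaurentC : Type := ℤ →₀ ℂ

/-- The `ℂ`-linear endomorphism of `ℂ[x,x⁻¹]` determined by its values on the monomials
`x^n`, `n : ℤ`. -/
noncomputable def onMonomials (g : ℤ → LaurentC) : LaurentC →ₗ[ℂ] LaurentC :=
  Finsupp.lsum ℂ fun n => LinearMap.toSpanSingleton ℂ LaurentC (g n)

/-- Multiplication by `x`. -/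
noncomputable def mulX : LaurentC →ₗ[ℂ] LaurentC :=
  onMonomials fun n => Finsupp.single (n + 1) 1

/-- The operator `s_i : x^n ↦ λ^{i n} x^n`. -/
noncomputable def sOp (lam : ℂ) (i : ℕ) : LaurentC →ₗ[ℂ] LaurentC :=
  onMonomials fun n => Finsupp.single n (lam ^ ((i : ℤ) * n))

/-- The Dunkl operator
`D(x^n) = n x^{n-1} + p·x^n + Σ_{i=1}^{m-1} (2 c_i (1-λ^{in})/(1-λ^i)) x^{n-1}`. -/
noncomputable def dunkl (m : ℕ) (lam : ℂ) (c : ℕ → ℂ) (p : LaurentC) : LaurentC →ₗ[ℂ] LaurentC :=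
  onMonomials fun n =>
    Finsupp.mapDomain (· + n) p +
      ((n : ℂ) + ∑ i ∈ Finset.Icc 1 (m - 1),
          2 * c i * (1 - lam ^ ((i : ℤ) * n)) / (1 - lam ^ (i : ℤ))) • Finsupp.single (n - 1) 1

/-- A subspace `N ⊆ ℂ[x,x⁻¹]` is an invariant subspace if it is closed under multiplication
by `x`, under `s_1`, and under the Dunkl operator `D`; invariant subspaces are exactly the
submodules of the rational Cherednik algebra module `j₀M`. -/
def IsInvariantSubspace (m : ℕ) (lam : ℂ) (c : ℕ → ℂ) (p : LaurentC) (N : Submodule ℂ LaurentC) : Prop :=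
  (∀ f ∈ N, mulX f ∈ N) ∧ (∀ f ∈ N, sOp lam 1 f ∈ N) ∧ (∀ f ∈ N, dunkl m lam c p f ∈ N)

/-- The subspace `x^k ℂ[x]`: the span of the monomials `x^n` with `n ≥ k`. -/
noncomputable def tailSpace (k : ℤ) : Submodule ℂ LaurentC :=
  Submodule.span ℂ {f : LaurentC | ∃ n : ℤ, k ≤ n ∧ f = Finsupp.single n 1}

theorem mem_tailSpace (k : ℤ) (f : LaurentC) : f ∈ tailSpace k ↔ ∀ n < k, f n = 0 := by
  constructor
  · intro hf
    induction hf using Submodule.span_induction with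
    | mem x hx =>
      obtain ⟨n, hn, rfl⟩ := hx
      intro j hj
      rw [Finsupp.single_apply, if_neg (by omega)]
    | zero => intro j _; rfl
    | add x y _ _ hx hy =>
      intro j hj
      rw [Finsupp.add_apply, hx j hj, hy j hj, add_zero]
    | smul a x _ hx =>
      intro j hj
      rw [Finsupp.smul_apply, hx j hj, smul_zero]
  · intro h
    rw [← Finsupp.sum_single f]
    refine Submodule.sum_mem _ fun n hn => ?_
    have hk : k ≤ n := by
      by_contra hlt
      exact (Finsupp.mem_support_iff.mp hn) (h n (by omega))
    have : Finsupp.single n (f n) = f n • (Finsupp.single n 1 : LaurentC) := by simp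
    rw [this]
    exact Submodule.smul_mem _ _ (Submodule.subset_span ⟨n, hk, rfl⟩)

theorem onMonomials_single (g : ℤ → LaurentC) (n : ℤ) :
    onMonomials g (Finsupp.single n 1) = g n := by
  simp [onMonomials]

theorem onMonomials_tail (g : ℤ → LaurentC) (k : ℤ) :
    (∀ f ∈ tailSpace k, onMonomials g f ∈ tailSpace k) ↔
      ∀ n, k ≤ n → ∀ j < k, g n j = 0 := by
  constructor
  · intro h n hn
    rw [← mem_tailSpace, ← onMonomials_single g n]
    exact h _ (Submodule.subset_span ⟨n, hn, rfl⟩)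
  · intro h
    have : tailSpace k ≤ (tailSpace k).comap (onMonomials g) := by
      conv_lhs => rw [tailSpace]
      rw [Submodule.span_le]
      rintro _ ⟨n, hn, rfl⟩
      simp only [SetLike.mem_coe, Submodule.mem_comap]
      rw [onMonomials_single, mem_tailSpace]
      exact h n hn
    exact this

theorem shift_apply (p : LaurentC) (n j : ℤ) :
    Finsupp.mapDomain (· + n) p j = p (j - n) := by
  have := Finsupp.mapDomain_apply (add_left_injective n) p (j - n)
  simpa using this

/-- `x^k ℂ[x]` is an invariant subspace iff `x·p` has no terms of negative degree and
`k + p₋₁ + Σ_{i=1}^{m−1} 2c_i(1−λ^{ik})/(1−λ^i) = 0`. -/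
theorem tailSpace_invariant_iff
    (m : ℕ) (hm : 2 ≤ m) (lam : ℂ) (hlam : IsPrimitiveRoot lam m)
    (c : ℕ → ℂ) (p : LaurentC) (hp : ∀ n : ℤ, ¬ ((m : ℤ) ∣ (n + 1)) → p n = 0) (k : ℤ) :
    IsInvariantSubspace m lam c p (tailSpace k) ↔
      ((∀ n : ℤ, n < -1 → p n = 0) ∧
        (k : ℂ) + p (-1) + ∑ i ∈ Finset.Icc 1 (m - 1),
            2 * c i * (1 - lam ^ ((i : ℤ) * k)) / (1 - lam ^ (i : ℤ)) = 0) := by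
  unfold IsInvariantSubspace mulX sOp dunkl
  rw [onMonomials_tail, onMonomials_tail, onMonomials_tail]
  constructor
  · rintro ⟨-, -, h⟩
    constructor
    · intro n hn
      have := h k le_rfl (k + n) (by omega)
      rw [Finsupp.add_apply, shift_apply, Finsupp.smul_apply, Finsupp.single_apply,
        if_neg (by omega), smul_zero, add_zero] at this
      simpa using this
    · have := h k le_rfl (k - 1) (by omega)
      rw [Finsupp.add_apply, shift_apply, Finsupp.smul_apply, Finsupp.single_apply,
        if_pos rfl, smul_eq_mul, mul_one, show k - 1 - k = -1 by ring] at this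
      rw [← this]
      ring
  · rintro ⟨ha, hb⟩
    refine ⟨?_, ?_, ?_⟩
    · intro n hn j hj
      rw [Finsupp.single_apply, if_neg (by omega)]
    · intro n hn j hj
      rw [Finsupp.single_apply, if_neg (by omega)]
    · intro n hn j hj
      rw [Finsupp.add_apply, shift_apply, Finsupp.smul_apply, Finsupp.single_apply]
      by_cases hjn : n - 1 = j
      · obtain rfl : n = k := by omega
        rw [if_pos hjn, smul_eq_mul, mul_one, show j - n = -1 by omega, ← hb]
        ring
      · rw [if_neg hjn, ha _ (by omega), smul_zero, add_zero]
end
end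

section
/- There exists an integer K ≥ 0 such that for every integer k ≥ K, the smallest invariant subspace of ℂ[x,x⁻¹] containing the monomial x^{−k} is ℂ[x,x⁻¹] itself. In particular, the module j₀M is a cyclic (hence finitely generated) module over the rational Cherednik algebra, generated by x^{−k} for any sufficiently large k. -/
noncomputable section

theorem aux_dunkl_apply (m : ℕ) (lam : ℂ) (c : ℕ → ℂ) (p : LaurentC) (n j : ℤ) :
    dunkl m lam c p (Finsupp.single n 1) j = p (j - n) +
      ((n : ℂ) + ∑ i ∈ Finset.Icc 1 (m - 1),
          2 * c i * (1 - lam ^ ((i : ℤ) * n)) / (1 - lam ^ (i : ℤ))) *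
        (if n - 1 = j then 1 else 0) := by
  have h : Finsupp.mapDomain (· + n) p j = p (j - n) := by
    have := Finsupp.mapDomain_apply (f := (· + n)) (add_left_injective n) p (j - n)
    simpa using this
  simp only [dunkl, onMonomials, Finsupp.lsum_single, LinearMap.toSpanSingleton_apply, one_smul,
    Finsupp.add_apply, h, Finsupp.smul_apply, Finsupp.single_apply, smul_eq_mul]

theorem aux_step (N : Submodule ℂ LaurentC) (n : ℤ)
    (ht : ∀ j : ℤ, n ≤ j → Finsupp.single j (1 : ℂ) ∈ N)
    (f : LaurentC) (hf : f ∈ N) (h0 : f (n - 1) ≠ 0) (hl : ∀ j < n - 1, f j = 0) :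
    Finsupp.single (n - 1) (1 : ℂ) ∈ N := by
  have h1 : f - Finsupp.single (n - 1) (f (n - 1)) ∈ N := by
    rw [← Finsupp.sum_single (f - Finsupp.single (n - 1) (f (n - 1)))]
    refine Submodule.sum_mem _ fun j hj => ?_
    have hj' := Finsupp.mem_support_iff.1 hj
    rw [← mul_one ((f - Finsupp.single (n - 1) (f (n - 1))) j), ← smul_eq_mul,
      ← Finsupp.smul_single]
    refine Submodule.smul_mem _ _ (ht j ?_)
    by_contra hlt
    apply hj'
    rcases eq_or_lt_of_le (show j ≤ n - 1 by omega) with h | h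
    · subst h; simp
    · rw [Finsupp.sub_apply, hl j h, Finsupp.single_eq_of_ne (by omega), sub_zero]
  have h2 : Finsupp.single (n - 1) (f (n - 1)) ∈ N := by
    have := N.sub_mem hf h1
    simpa using this
  have h3 := N.smul_mem (f (n - 1))⁻¹ h2
  rwa [Finsupp.smul_single, smul_eq_mul, inv_mul_cancel₀ h0] at h3

theorem aux_top (N : Submodule ℂ LaurentC) (hx : ∀ f ∈ N, mulX f ∈ N) (k : ℤ)
    (hk : Finsupp.single (-k) (1 : ℂ) ∈ N)
    (h : ∀ n ≤ -k, (∀ j : ℤ, n ≤ j → Finsupp.single j (1 : ℂ) ∈ N) →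
      ∃ f ∈ N, f (n - 1) ≠ 0 ∧ ∀ j < n - 1, f j = 0) : N = ⊤ := by
  have up : ∀ j : ℤ, -k ≤ j → Finsupp.single j (1 : ℂ) ∈ N := by
    intro j hj
    induction j, hj using Int.le_induction with
    | base => exact hk
    | succ j _ ih => simpa [mulX, onMonomials] using hx _ ih
  have down : ∀ t : ℕ, ∀ j : ℤ, -k - t ≤ j → Finsupp.single j (1 : ℂ) ∈ N := by
    intro t
    induction t with
    | zero => intro j hj; exact up j (by simpa using hj)
    | succ t ih =>
      intro j hj
      push_cast at hj
      by_cases hj' : -k - t ≤ j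
      · exact ih j hj'
      · obtain ⟨f, hf, h0, hl⟩ := h (-k - t) (by omega) ih
        have := aux_step N _ ih f hf h0 hl
        rwa [show j = -k - t - 1 by omega]
  have all : ∀ j : ℤ, Finsupp.single j (1 : ℂ) ∈ N := fun j =>
    down (-k - j).toNat j (by omega)
  rw [eq_top_iff]
  intro f _
  rw [← Finsupp.sum_single f]
  refine Submodule.sum_mem _ fun j _ => ?_
  have := N.smul_mem (f j) (all j)
  rwa [Finsupp.smul_single, smul_eq_mul, mul_one] at this

/-- There is `K ≥ 0` such that for every `k ≥ K` the smallest invariant subspace containing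
the monomial `x^{−k}` is all of `ℂ[x,x⁻¹]`: `j₀M` is a cyclic module over the rational
Cherednik algebra, generated by `x^{−k}` for any sufficiently large `k`. -/
theorem generated_by_large_negative_monomial
    (m : ℕ) (hm : 2 ≤ m) (lam : ℂ) (hlam : IsPrimitiveRoot lam m)
    (c : ℕ → ℂ) (p : LaurentC) (hp : ∀ n : ℤ, ¬ ((m : ℤ) ∣ (n + 1)) → p n = 0) :
    ∃ K : ℤ, 0 ≤ K ∧ ∀ k : ℤ, K ≤ k →
      ∀ N : Submodule ℂ LaurentC, IsInvariantSubspace m lam c p N →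
        Finsupp.single (-k) (1 : ℂ) ∈ N → N = ⊤ := by
  by_cases hs : ∃ s ∈ p.support, s < -1
  · obtain ⟨s0, hs0, hs1⟩ := hs
    have hne : p.support.Nonempty := ⟨s0, hs0⟩
    set s := p.support.min' hne with hsdef
    have hmem : p s ≠ 0 := Finsupp.mem_support_iff.1 (p.support.min'_mem hne)
    have hle : s ≤ s0 := p.support.min'_le _ hs0
    have hz : ∀ j < s, p j = 0 := by
      intro j hj
      by_contra hc
      have := p.support.min'_le j (Finsupp.mem_support_iff.2 hc)
      omega
    refine ⟨0, le_rfl, fun k _ N hN hkN => aux_top N hN.1 k hkN fun n _ ht => ?_⟩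
    refine ⟨_, hN.2.2 _ (ht (n - s - 1) (by omega)), ?_, ?_⟩
    · rw [aux_dunkl_apply, if_neg (by omega), mul_zero, add_zero]
      rwa [show n - 1 - (n - s - 1) = s by ring]
    · intro j hj
      rw [aux_dunkl_apply, if_neg (by omega), mul_zero, add_zero]
      exact hz _ (by omega)
  · push Not at hs
    have hz : ∀ j < -1, p j = 0 := by
      intro j hj
      by_contra hc
      have := hs j (Finsupp.mem_support_iff.2 hc)
      omega
    have hl1 : ‖lam‖ = 1 := hlam.norm'_eq_one (by omega)
    set B : ℝ := ∑ i ∈ Finset.Icc 1 (m - 1), ‖2 * c i‖ * 2 / ‖1 - lam ^ (i : ℤ)‖ with hB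
    have hB0 : 0 ≤ B := Finset.sum_nonneg fun i _ => by positivity
    have hbd : ∀ n : ℤ, ‖∑ i ∈ Finset.Icc 1 (m - 1),
          2 * c i * (1 - lam ^ ((i : ℤ) * n)) / (1 - lam ^ (i : ℤ))‖ ≤ B := by
      intro n
      refine norm_sum_le_of_le _ fun i _ => ?_
      rw [norm_div, norm_mul]
      gcongr
      refine (norm_sub_le _ _).trans ?_
      rw [norm_zpow, hl1]
      norm_num
    refine ⟨⌈B + ‖p (-1)‖⌉ + 1, ?_, fun k hk N hN hkN => aux_top N hN.1 k hkN fun n hn ht => ?_⟩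
    · have : 0 ≤ ⌈B + ‖p (-1)‖⌉ := Int.ceil_nonneg (by positivity)
      omega
    refine ⟨_, hN.2.2 _ (ht n le_rfl), ?_, ?_⟩
    · rw [aux_dunkl_apply, if_pos rfl, mul_one, show n - 1 - n = -1 by ring]
      intro h
      have hb := hbd n
      set S := ∑ i ∈ Finset.Icc 1 (m - 1),
          2 * c i * (1 - lam ^ ((i : ℤ) * n)) / (1 - lam ^ (i : ℤ))
      have e : (n : ℂ) = -(p (-1) + S) := by linear_combination h
      have e2 : ‖(n : ℂ)‖ ≤ ‖p (-1)‖ + ‖S‖ := by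
        rw [e, norm_neg]; exact norm_add_le _ _
      rw [Complex.norm_intCast] at e2
      have h3 : B + ‖p (-1)‖ ≤ (⌈B + ‖p (-1)‖⌉ : ℝ) := Int.le_ceil _
      have h4 : ((⌈B + ‖p (-1)‖⌉ : ℤ) : ℝ) + 1 ≤ -(n : ℝ) := by
        exact_mod_cast (show ⌈B + ‖p (-1)‖⌉ + 1 ≤ -n by omega)
      have h5 := neg_le_abs (n : ℝ)
      linarith
    · intro j hj
      rw [aux_dunkl_apply, if_neg (by omega), mul_zero, add_zero]
      exact hz _ (by omega)
end
end
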